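/- arXiv:1502.02863 — 4 statements merged into one kernel-verified Lean document; each statement's English description precedes it below -/
import Mathlib

section
/- Let N_a and N_b be independent random variables on a probability space, where N_a has the Poisson distribution with parameter λ_a·τ and N_b has the Poisson distribution with parameter λ_b·τ, for reals λ_a, λ_b ≥ 0 and τ ≥ 0. Fix reals x, y, s, k, δ_a, δ_b and set X = x + N_b − N_a and Y = y − (s − δ_b)N_b + (s + δ_a)N_a. Then E[Y + X·s − k·X²] = y + x·s + c₁·τ − k(x + c₂·τ)², where c₁ = λ_a δ_a + λ_b δ_b − k(λ_a + λ_b) and c₂ = λ_b − λ_a. -/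
open MeasureTheory ProbabilityTheory

namespace ProbabilityTheory

open scoped NNReal Nat

lemma hasSum_poisson_natCast_mul {r : ℝ} {f : ℕ → ℝ} {S : ℝ}
    (h : HasSum (fun n ↦ Real.exp (-r) * r ^ n / (n)! * f (n + 1)) S) :
    HasSum (fun n ↦ Real.exp (-r) * r ^ n / (n)! * (n * f n)) (r * S) := by
  rw [← hasSum_nat_add_iff' 1]
  convert! h.mul_left r using 1
  · ext n
    rw [Nat.factorial_succ]
    have : ((n)! : ℝ) ≠ 0 := by positivity
    have : (n : ℝ) + 1 ≠ 0 := by positivity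
    push_cast
    field_simp
    ring
  · simp

lemma hasSum_poisson_natCast (r : ℝ≥0) :
    HasSum (fun n : ℕ ↦ Real.exp (-r) * (r : ℝ) ^ n / (n)! * n) r := by
  have h := hasSum_poisson_natCast_mul (r := r) (f := fun _ ↦ 1) (S := 1)
    (by simpa using hasSum_one_poissonMeasure r)
  simpa only [mul_one] using h

lemma hasSum_poisson_natCast_sq (r : ℝ≥0) :
    HasSum (fun n : ℕ ↦ Real.exp (-r) * (r : ℝ) ^ n / (n)! * (n : ℝ) ^ 2) (r * (r + 1)) := by
  simpa [sq] using hasSum_poisson_natCast_mul (f := fun n ↦ (n : ℝ))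
    (by simpa [mul_add] using (hasSum_poisson_natCast r).add (hasSum_one_poissonMeasure r))

lemma integrable_natCast_poissonMeasure (r : ℝ≥0) :
    Integrable (fun n : ℕ ↦ (n : ℝ)) (poissonMeasure r) :=
  integrable_poissonMeasure_iff.2 (by simpa using (hasSum_poisson_natCast r).summable)

lemma integrable_natCast_sq_poissonMeasure (r : ℝ≥0) :
    Integrable (fun n : ℕ ↦ (n : ℝ) ^ 2) (poissonMeasure r) :=
  integrable_poissonMeasure_iff.2 (by simpa using (hasSum_poisson_natCast_sq r).summable)

lemma integral_natCast_poissonMeasure (r : ℝ≥0) :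
    ∫ n, (n : ℝ) ∂(poissonMeasure r) = r := by
  simpa [integral_poissonMeasure] using (hasSum_poisson_natCast r).tsum_eq

lemma integral_natCast_sq_poissonMeasure (r : ℝ≥0) :
    ∫ n, (n : ℝ) ^ 2 ∂(poissonMeasure r) = r * (r + 1) := by
  simpa [integral_poissonMeasure] using (hasSum_poisson_natCast_sq r).tsum_eq

lemma HasLaw.poissonMeasure_moments {Ω : Type*} [MeasurableSpace Ω] {μ : Measure Ω}
    {N : Ω → ℕ} {r : ℝ≥0} (h : HasLaw N (poissonMeasure r) μ) :
    Integrable (fun ω ↦ (N ω : ℝ)) μ ∧ Integrable (fun ω ↦ (N ω : ℝ) ^ 2) μ ∧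
      ∫ ω, (N ω : ℝ) ∂μ = r ∧ ∫ ω, (N ω : ℝ) ^ 2 ∂μ = r * (r + 1) := by
  have hm := h.aemeasurable
  have key (f : ℕ → ℝ) (hf : Integrable f (poissonMeasure r)) :
      Integrable (fun ω ↦ f (N ω)) μ ∧ ∫ ω, f (N ω) ∂μ = ∫ n, f n ∂(poissonMeasure r) := by
    rw [← h.map_eq] at hf ⊢
    exact ⟨hf.comp_aemeasurable hm, (integral_map hm hf.1).symm⟩
  obtain ⟨h₁, e₁⟩ := key _ (integrable_natCast_poissonMeasure r)
  obtain ⟨h₂, e₂⟩ := key _ (integrable_natCast_sq_poissonMeasure r)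
  exact ⟨h₁, h₂, e₁.trans (integral_natCast_poissonMeasure r),
    e₂.trans (integral_natCast_sq_poissonMeasure r)⟩

end ProbabilityTheory

/-- For independent Poisson variables `Na`, `Nb` with parameters `λa·τ`, `λb·τ`, setting
`X = x + Nb − Na` and `Y = y − (s − δb)Nb + (s + δa)Na`, one has
`E[Y + X·s − k·X²] = y + x·s + c₁·τ − k(x + c₂·τ)²` with
`c₁ = λa δa + λb δb − k(λa + λb)` and `c₂ = λb − λa`. -/
theorem expected_terminal_value {Ω : Type*} [MeasurableSpace Ω] (μ : Measure Ω)
    [IsProbabilityMeasure μ] (Na Nb : Ω → ℕ)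
    (lamA lamB τ : ℝ) (hA : 0 ≤ lamA) (hB : 0 ≤ lamB) (hτ : 0 ≤ τ)
    (hindep : IndepFun Na Nb μ)
    (hNa : μ.map Na = poissonMeasure ⟨lamA * τ, mul_nonneg hA hτ⟩)
    (hNb : μ.map Nb = poissonMeasure ⟨lamB * τ, mul_nonneg hB hτ⟩)
    (x y s k da db : ℝ)
    (X : Ω → ℝ) (hX : ∀ ω, X ω = x + (Nb ω : ℝ) - (Na ω : ℝ))
    (Y : Ω → ℝ) (hY : ∀ ω, Y ω = y - (s - db) * (Nb ω : ℝ) + (s + da) * (Na ω : ℝ)) :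
    ∫ ω, (Y ω + X ω * s - k * X ω ^ 2) ∂μ
      = y + x * s + (lamA * da + lamB * db - k * (lamA + lamB)) * τ
          - k * (x + (lamB - lamA) * τ) ^ 2 := by
  have law {N : Ω → ℕ} {r : NNReal} (h : μ.map N = poissonMeasure r) :
      HasLaw N (poissonMeasure r) μ :=
    ⟨AEMeasurable.of_map_ne_zero (h ▸ IsProbabilityMeasure.ne_zero _), h⟩
  obtain ⟨ia, ia2, ea, ea2⟩ := (law hNa).poissonMeasure_moments
  obtain ⟨ib, ib2, eb, eb2⟩ := (law hNb).poissonMeasure_moments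
  have hi : IndepFun (fun ω ↦ (Na ω : ℝ)) (fun ω ↦ (Nb ω : ℝ)) μ :=
    hindep.comp (φ := fun n : ℕ ↦ (n : ℝ)) (ψ := fun n : ℕ ↦ (n : ℝ))
      .of_discrete .of_discrete
  have iab : Integrable (fun ω ↦ (Na ω : ℝ) * (Nb ω : ℝ)) μ := hi.integrable_mul ia ib
  change _ = lamA * τ at ea
  change _ = lamB * τ at eb
  change _ = lamA * τ * (lamA * τ + 1) at ea2
  change _ = lamB * τ * (lamB * τ + 1) at eb2
  have eab : ∫ ω, (Na ω : ℝ) * (Nb ω : ℝ) ∂μ = (lamA * τ) * (lamB * τ) := by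
    rw [hi.integral_fun_mul_eq_mul_integral ia.1 ib.1, ea, eb]
  calc ∫ ω, (Y ω + X ω * s - k * X ω ^ 2) ∂μ
      = ∫ ω, ((y + x * s - k * x ^ 2) + (db - 2 * k * x) * (Nb ω : ℝ)
          + (da + 2 * k * x) * (Na ω : ℝ) + -k * (Nb ω : ℝ) ^ 2 + -k * (Na ω : ℝ) ^ 2
          + 2 * k * ((Na ω : ℝ) * (Nb ω : ℝ))) ∂μ := by
        congr with ω
        rw [hX, hY]
        ring
    _ = _ := by
        rw [integral_add (by fun_prop) (by fun_prop), integral_add (by fun_prop) (by fun_prop),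
          integral_add (by fun_prop) (by fun_prop), integral_add (by fun_prop) (by fun_prop),
          integral_add (by fun_prop) (by fun_prop)]
        simp only [integral_const_mul, integral_const, probReal_univ, one_smul,
          ea, ea2, eb, eb2, eab]
        ring
end

section
/- Let k > 0, ε_m > 0, ε_l > 0, p ∈ (0,1) and u ∈ ℝ, and define D(u) = −k u², MB(u) = −(k+ε_m) − k(u+1)², MS(u) = −(k+ε_m) − k(u−1)², LB(u) = (kp−ε_l) − k(u+p)², LS(u) = (kp−ε_l) − k(u−p)². If u < min{ −ε_m/(2k) − 1 , (ε_l − 2k − ε_m)/(2k(1−p)) − p/2 }, then MB(u) > D(u), MB(u) > LB(u), MB(u) > LS(u) and MB(u) > MS(u); that is, a unit market buy order is the strictly optimal one-step action. -/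
/-- In the region `u < min{−ε_m/(2k) − 1, (ε_l − 2k − ε_m)/(2k(1−p)) − p/2}`, a unit market
buy order is the strictly optimal one-step action. -/
theorem market_buy_region_optimal (k em el p u : ℝ) (hk : 0 < k) (hem : 0 < em)
    (hel : 0 < el) (hp0 : 0 < p) (hp1 : p < 1)
    (D MB MS LB LS : ℝ → ℝ)
    (hD : ∀ v, D v = -k * v ^ 2)
    (hMB : ∀ v, MB v = -(k + em) - k * (v + 1) ^ 2)
    (hMS : ∀ v, MS v = -(k + em) - k * (v - 1) ^ 2)
    (hLB : ∀ v, LB v = (k * p - el) - k * (v + p) ^ 2)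
    (hLS : ∀ v, LS v = (k * p - el) - k * (v - p) ^ 2)
    (hu : u < min (-em / (2 * k) - 1) ((el - 2 * k - em) / (2 * k * (1 - p)) - p / 2)) :
    MB u > D u ∧ MB u > LB u ∧ MB u > LS u ∧ MB u > MS u := by
  obtain ⟨hu₁, hu₂⟩ := lt_min_iff.mp hu
  have hk2 : 0 < 2 * k := by positivity
  have hkp : 0 < 2 * k * (1 - p) := mul_pos hk2 (sub_pos.mpr hp1)
  rw [lt_sub_iff_add_lt, lt_div_iff₀ hk2] at hu₁
  rw [lt_sub_iff_add_lt, lt_div_iff₀ hkp] at hu₂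
  have hku : k * u < 0 := by linarith
  have hkup : k * u * p < 0 := mul_neg_of_neg_of_pos hku hp0
  simp only [hD, hMB, hMS, hLB, hLS]
  refine ⟨?_, ?_, ?_, ?_⟩ <;> linarith
end

section
/- Let k > 0, ε_m > 0, ε_l > 0, p ∈ (0,1) with ε_m > ε_l and ε_l ≥ kp(1−p), let u ∈ ℝ, and define D(u) = −k u², MB(u) = −(k+ε_m) − k(u+1)², MS(u) = −(k+ε_m) − k(u−1)², LB(u) = (kp−ε_l) − k(u+p)², LS(u) = (kp−ε_l) − k(u−p)². If (ε_l − 2k − ε_m)/(2k(1−p)) − p/2 < u < −ε_l/(2kp) + (1−p)/2, then LB(u) > D(u), LB(u) > MB(u), LB(u) > LS(u) and LB(u) > MS(u); that is, a unit limit buy order is the strictly optimal one-step action. -/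
/-- Under `ε_m > ε_l` and `ε_l ≥ kp(1−p)`, in the region
`(ε_l − 2k − ε_m)/(2k(1−p)) − p/2 < u < −ε_l/(2kp) + (1−p)/2`, a unit limit buy order is
the strictly optimal one-step action. -/
theorem limit_buy_region_optimal (k em el p u : ℝ) (hk : 0 < k) (hem : 0 < em)
    (hel : 0 < el) (hp0 : 0 < p) (hp1 : p < 1) (hml : em > el)
    (hlkp : el ≥ k * p * (1 - p))
    (D MB MS LB LS : ℝ → ℝ)
    (hD : ∀ v, D v = -k * v ^ 2)
    (hMB : ∀ v, MB v = -(k + em) - k * (v + 1) ^ 2)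
    (hMS : ∀ v, MS v = -(k + em) - k * (v - 1) ^ 2)
    (hLB : ∀ v, LB v = (k * p - el) - k * (v + p) ^ 2)
    (hLS : ∀ v, LS v = (k * p - el) - k * (v - p) ^ 2)
    (hu1 : (el - 2 * k - em) / (2 * k * (1 - p)) - p / 2 < u)
    (hu2 : u < -el / (2 * k * p) + (1 - p) / 2) :
    LB u > D u ∧ LB u > MB u ∧ LB u > LS u ∧ LB u > MS u := by
  have hq : 0 < 1 - p := sub_pos.mpr hp1
  have hkp : 0 < k * p := mul_pos hk hp0
  have lower : el - 2 * k - em < (u + p / 2) * (2 * k * (1 - p)) := by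
    rw [← div_lt_iff₀ (by positivity)]
    linarith
  have upper : 2 * (k * p) * u < -el + k * p * (1 - p) := by
    have h : u - (1 - p) / 2 < -el / (2 * k * p) := by linarith
    rw [lt_div_iff₀ (by positivity)] at h
    linarith
  have hu : u < 0 := by
    by_contra! h
    have := mul_nonneg hkp.le h
    linarith
  have hku : k * u < 0 := mul_neg_of_pos_of_neg hk hu
  have hkpu : k * p * u < 0 := mul_neg_of_pos_of_neg hkp hu
  have hkpq : 0 < k * p * (1 - p) := mul_pos hkp hq
  rw [hLB, hD, hMB, hMS, hLS]
  refine ⟨?_, ?_, ?_, ?_⟩ <;> linarith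
end

section
/- Let k > 0, ε_m > 0, ε_l > 0, p ∈ (0,1) and u ∈ ℝ, and define D(u) = −k u², MB(u) = −(k+ε_m) − k(u+1)², MS(u) = −(k+ε_m) − k(u−1)², LB(u) = (kp−ε_l) − k(u+p)², LS(u) = (kp−ε_l) − k(u−p)². If u > max{ ε_m/(2k) + 1 , (−ε_l + 2k + ε_m)/(2k(1−p)) + p/2 }, then MS(u) > D(u), MS(u) > LS(u), MS(u) > LB(u) and MS(u) > MB(u); that is, a unit market sell order is the strictly optimal one-step action. -/
/-- In the region `u > max{ε_m/(2k) + 1, (−ε_l + 2k + ε_m)/(2k(1−p)) + p/2}`, a unit market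
sell order is the strictly optimal one-step action. -/
theorem market_sell_region_optimal (k em el p u : ℝ) (hk : 0 < k) (hem : 0 < em)
    (hel : 0 < el) (hp0 : 0 < p) (hp1 : p < 1)
    (D MB MS LB LS : ℝ → ℝ)
    (hD : ∀ v, D v = -k * v ^ 2)
    (hMB : ∀ v, MB v = -(k + em) - k * (v + 1) ^ 2)
    (hMS : ∀ v, MS v = -(k + em) - k * (v - 1) ^ 2)
    (hLB : ∀ v, LB v = (k * p - el) - k * (v + p) ^ 2)
    (hLS : ∀ v, LS v = (k * p - el) - k * (v - p) ^ 2)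
    (hu : u > max (em / (2 * k) + 1) ((-el + 2 * k + em) / (2 * k * (1 - p)) + p / 2)) :
    MS u > D u ∧ MS u > LS u ∧ MS u > LB u ∧ MS u > MB u := by
  obtain ⟨hu₁, hu₂⟩ := max_lt_iff.mp hu
  have hq : 0 < 2 * k * (1 - p) := mul_pos (by linarith) (by linarith)
  have h₁ : em < (u - 1) * (2 * k) := (div_lt_iff₀ (by linarith)).mp (by linarith)
  have h₂ : -el + 2 * k + em < (u - p / 2) * (2 * k * (1 - p)) :=
    (div_lt_iff₀ hq).mp (by linarith)
  have hu_pos : 0 < u := by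
    have : 0 < em / (2 * k) := by positivity
    linarith
  have hku : 0 < k * u := mul_pos hk hu_pos
  have hkup : 0 < k * u * p := mul_pos hku hp0
  rw [hMS, hD, hLS, hLB, hMB]
  refine ⟨?_, ?_, ?_, ?_⟩ <;> linarith
end
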